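/- For any tripartite state, Δ_P(A:B:C) ≥ Ĩ₃(A:B:C), where Ĩ₃(A:B:C) := S_A + S_B + S_C − S_{AB} − S_{BC} − S_{CA} + S_{ABC} is the tripartite information. -/

import Mathlib

open scoped BigOperators ComplexOrder

noncomputable section

/-- Von Neumann entropy of a matrix: `−∑ λᵢ log λᵢ` over its eigenvalues
(defined to be `0` if the matrix is not Hermitian). -/
noncomputable def matEntropy {ι : Type} [Fintype ι] [DecidableEq ι]
    (ρ : Matrix ι ι ℂ) : ℝ :=
  if h : ρ.IsHermitian then ∑ i, Real.negMulLog (h.eigenvalues i) else 0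

/-- A density matrix: positive semidefinite with unit trace. -/
def IsDensityMatrix {ι : Type} [Fintype ι] (ρ : Matrix ι ι ℂ) : Prop :=
  ρ.PosSemidef ∧ ρ.trace = 1

instance sumElimFintype {κ π : Type} {α : κ → Type} {δ : π → Type}
    [∀ i, Fintype (α i)] [∀ k, Fintype (δ k)] :
    ∀ i : κ ⊕ π, Fintype (Sum.elim α δ i)
  | .inl a => inferInstanceAs (Fintype (α a))
  | .inr b => inferInstanceAs (Fintype (δ b))

instance sumElimDecEq {κ π : Type} {α : κ → Type} {δ : π → Type}
    [∀ i, DecidableEq (α i)] [∀ k, DecidableEq (δ k)] :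
    ∀ i : κ ⊕ π, DecidableEq (Sum.elim α δ i)
  | .inl a => inferInstanceAs (DecidableEq (α a))
  | .inr b => inferInstanceAs (DecidableEq (δ b))

/-- Reduced density matrix on the subsystems in `s` (partial trace over the rest). -/
noncomputable def reduce {κ : Type} [Fintype κ] [DecidableEq κ] {α : κ → Type}
    [∀ i, Fintype (α i)] (s : Finset κ)
    (ρ : Matrix (∀ i, α i) (∀ i, α i) ℂ) :
    Matrix (∀ i : {j // j ∈ s}, α i.1) (∀ i : {j // j ∈ s}, α i.1) ℂ :=
  Matrix.of fun f g => ∑ h : ∀ i : {j // j ∉ s}, α i.1,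
    ρ (fun i => if hi : i ∈ s then f ⟨i, hi⟩ else h ⟨i, hi⟩)
      (fun i => if hi : i ∈ s then g ⟨i, hi⟩ else h ⟨i, hi⟩)

/-- The (pure) density matrix `|ψ⟩⟨ψ|` of a state vector. -/
def vecState {ι : Type} (ψ : ι → ℂ) : Matrix ι ι ℂ :=
  Matrix.of fun x y => ψ x * star (ψ y)

/-- Multipartite mutual information `∑ᵢ S_{Aᵢ} − S_{A₁⋯Aₙ}`. -/
noncomputable def Imulti {κ : Type} [Fintype κ] [DecidableEq κ] {α : κ → Type}
    [∀ i, Fintype (α i)] [∀ i, DecidableEq (α i)]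
    (ρ : Matrix (∀ i, α i) (∀ i, α i) ℂ) : ℝ :=
  (∑ i, matEntropy (reduce {i} ρ)) - matEntropy ρ

/-- Merge an assignment on the original systems with one on the ancillas. -/
def mergeSum {κ π : Type} {α : κ → Type} {δ : π → Type}
    (f : ∀ i, α i) (h : ∀ k, δ k) : ∀ i : κ ⊕ π, Sum.elim α δ i
  | .inl a => f a
  | .inr b => h b

/-- The subsystems belonging to party `k` together with its ancilla. -/
def partyFinset {κ π : Type} [Fintype κ] [DecidableEq κ] [DecidableEq π]
    (p : κ → π) (k : π) : Finset (κ ⊕ π) :=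
  (Finset.univ.filter fun i => p i = k).image Sum.inl ∪ {Sum.inr k}

/-- `ψ` (on the original systems plus one ancilla `Fin (d k)` per party)
purifies `ρ`: tracing out all ancillas from `|ψ⟩⟨ψ|` gives back `ρ`. -/
def Purifies {κ π : Type} [Fintype κ] {α : κ → Type} [∀ i, Fintype (α i)]
    [Fintype π] [DecidableEq π] {d : π → ℕ}
    (ψ : (∀ i : κ ⊕ π, Sum.elim α (fun k => Fin (d k)) i) → ℂ)
    (ρ : Matrix (∀ i, α i) (∀ i, α i) ℂ) : Prop :=
  ∀ f g, (∑ h : ∀ k, Fin (d k), vecState ψ (mergeSum f h) (mergeSum g h)) = ρ f g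

/-- Multipartite entanglement of purification for the partition of the systems `κ`
into parties `π` given by `p`: the infimum over all purifications (with one ancilla
per party, of arbitrary finite dimension) of `∑ₖ S_{AₖAₖ'}`. -/
noncomputable def DeltaPart {κ π : Type} [Fintype κ] [DecidableEq κ]
    [Fintype π] [DecidableEq π] {α : κ → Type}
    [∀ i, Fintype (α i)] [∀ i, DecidableEq (α i)]
    (p : κ → π) (ρ : Matrix (∀ i, α i) (∀ i, α i) ℂ) : ℝ :=
  sInf { x | ∃ (d : π → ℕ) (ψ : (∀ i : κ ⊕ π, Sum.elim α (fun k => Fin (d k)) i) → ℂ),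
    Purifies ψ ρ ∧
    x = ∑ k : π, matEntropy (reduce (partyFinset p k) (vecState ψ)) }

/-- Bipartite-style entanglement of purification for the partition `p`:
the infimum over purifications of the entropy of the single party `k₀`
together with its ancilla. -/
noncomputable def EPart {κ π : Type} [Fintype κ] [DecidableEq κ]
    [Fintype π] [DecidableEq π] {α : κ → Type}
    [∀ i, Fintype (α i)] [∀ i, DecidableEq (α i)]
    (p : κ → π) (k₀ : π) (ρ : Matrix (∀ i, α i) (∀ i, α i) ℂ) : ℝ :=
  sInf { x | ∃ (d : π → ℕ) (ψ : (∀ i : κ ⊕ π, Sum.elim α (fun k => Fin (d k)) i) → ℂ),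
    Purifies ψ ρ ∧
    x = matEntropy (reduce (partyFinset p k₀) (vecState ψ)) }

open Matrix

/-- The pairing in the variational formula for `∑ |w|² p² / ((1 - s) q + s p)`. -/
def varFun {I : Type} [Fintype I] (s : ℝ) (X ρ σ : Matrix I I ℂ) : ℝ :=
  2 * (trace (Xᴴ * ρ)).re - (1 - s) * (trace (X * Xᴴ * σ)).re - s * (trace (Xᴴ * X * ρ)).re

/-- `ρ = U diag(p) Uᴴ` with `U` unitary. -/
structure Diagonalizes {I : Type} [Fintype I] [DecidableEq I]
    (U : Matrix I I ℂ) (p : I → ℝ) (ρ : Matrix I I ℂ) : Prop where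
  mul_conj : U * Uᴴ = 1
  conj_mul : Uᴴ * U = 1
  eq : ρ = U * diagonal (fun i => (p i : ℂ)) * Uᴴ

lemma trace_conj_mul_diagonal {I : Type} [Fintype I] [DecidableEq I]
    (Y W : Matrix I I ℂ) (p : I → ℝ) :
    (trace (Yᴴ * W * diagonal (fun i => (p i : ℂ)))).re =
      ∑ j, ∑ i, (star (Y j i) * W j i).re * p i := by
  rw [trace, Complex.re_sum, Finset.sum_comm]
  refine Finset.sum_congr rfl fun i _ => ?_
  rw [diag_apply, mul_diagonal, Complex.re_mul_ofReal, mul_apply, Complex.re_sum,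
    Finset.sum_mul]
  rfl

lemma varFun_eq {I : Type} [Fintype I] [DecidableEq I] {U V ρ σ : Matrix I I ℂ} {p q : I → ℝ}
    (hU : Diagonalizes U p ρ) (hV : Diagonalizes V q σ) (s : ℝ) (Y : Matrix I I ℂ) :
    varFun s (V * Y * Uᴴ) ρ σ = ∑ j, ∑ i, (2 * (star (Y j i) * (Vᴴ * U) j i).re * p i
      - Complex.normSq (Y j i) * ((1 - s) * q j + s * p i)) := by
  have h1 : trace ((V * Y * Uᴴ)ᴴ * ρ)
      = trace (Yᴴ * (Vᴴ * U) * diagonal (fun i => (p i : ℂ))) := by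
    rw [hU.eq, ← Matrix.mul_assoc, ← Matrix.mul_assoc, trace_mul_comm]
    simp only [conjTranspose_mul, conjTranspose_conjTranspose, ← Matrix.mul_assoc, hU.conj_mul,
      Matrix.one_mul]
  have h2 : trace (V * Y * Uᴴ * (V * Y * Uᴴ)ᴴ * σ)
      = trace (Yᴴᴴ * Yᴴ * diagonal (fun i => (q i : ℂ))) := by
    rw [hV.eq, ← Matrix.mul_assoc, ← Matrix.mul_assoc, trace_mul_comm]
    simp only [conjTranspose_mul, conjTranspose_conjTranspose, ← Matrix.mul_assoc, hV.conj_mul,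
      Matrix.one_mul]
    rw [Matrix.mul_assoc Y Uᴴ U, hU.conj_mul, Matrix.mul_one, Matrix.mul_assoc (Y * Yᴴ) Vᴴ V,
      hV.conj_mul, Matrix.mul_one]
  have h3 : trace ((V * Y * Uᴴ)ᴴ * (V * Y * Uᴴ) * ρ)
      = trace (Yᴴ * Y * diagonal (fun i => (p i : ℂ))) := by
    rw [hU.eq, ← Matrix.mul_assoc, ← Matrix.mul_assoc, trace_mul_comm]
    simp only [conjTranspose_mul, conjTranspose_conjTranspose, ← Matrix.mul_assoc, hU.conj_mul,
      Matrix.one_mul]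
    rw [Matrix.mul_assoc Yᴴ Vᴴ V, hV.conj_mul, Matrix.mul_one, Matrix.mul_assoc (Yᴴ * Y) Uᴴ U,
      hU.conj_mul, Matrix.mul_one]
  rw [varFun, h1, h2, h3, trace_conj_mul_diagonal, trace_conj_mul_diagonal,
    trace_conj_mul_diagonal]
  rw [Finset.sum_comm (f := fun j i => (star (Yᴴ j i) * Yᴴ j i).re * q i)]
  simp only [Finset.mul_sum, ← Finset.sum_sub_distrib]
  refine Finset.sum_congr rfl fun j _ => Finset.sum_congr rfl fun i _ => ?_
  simp only [conjTranspose_apply, Complex.star_def, Complex.normSq_apply,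
    Complex.mul_re, Complex.conj_re, Complex.conj_im]
  ring

/-- The resolvent form of the relative entropy integrand. -/
def resolventForm {I : Type} [Fintype I] (W : Matrix I I ℂ) (p q : I → ℝ) (s : ℝ) : ℝ :=
  ∑ j, ∑ i, Complex.normSq (W j i) * (p i ^ 2 / ((1 - s) * q j + s * p i))

lemma varFun_le {I : Type} [Fintype I] [DecidableEq I] {U V ρ σ : Matrix I I ℂ} {p q : I → ℝ}
    (hU : Diagonalizes U p ρ) (hV : Diagonalizes V q σ) (hp : ∀ i, 0 ≤ p i) (hq : ∀ i, 0 ≤ q i)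
    {s : ℝ} (hs : 0 < s) (hs1 : s < 1) (X : Matrix I I ℂ) :
    varFun s X ρ σ ≤ resolventForm (Vᴴ * U) p q s := by
  have hX : X = V * (Vᴴ * X * U) * Uᴴ := by
    rw [Matrix.mul_assoc Vᴴ, ← Matrix.mul_assoc, hV.mul_conj, Matrix.one_mul, Matrix.mul_assoc,
      hU.mul_conj, Matrix.mul_one]
  rw [hX, varFun_eq hU hV, resolventForm]
  refine Finset.sum_le_sum fun j _ => Finset.sum_le_sum fun i _ => ?_
  generalize (Vᴴ * X * U) j i = y
  generalize (Vᴴ * U) j i = w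
  have hq' : 0 ≤ (1 - s) * q j := mul_nonneg (by linarith) (hq j)
  have hp' : 0 ≤ s * p i := mul_nonneg hs.le (hp i)
  rcases (add_nonneg hq' hp').eq_or_lt with h | h
  · have : p i = 0 := by
      have : s * p i = 0 := by linarith
      simpa [hs.ne'] using this
    rw [← h, this]; simp
  · set c := (1 - s) * q j + s * p i
    rw [mul_div_assoc', le_div_iff₀ h]
    simp only [Complex.normSq_apply, Complex.star_def, Complex.mul_re, Complex.conj_re,
      Complex.conj_im]
    nlinarith [sq_nonneg (y.re * c - w.re * p i), sq_nonneg (y.im * c - w.im * p i)]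

lemma exists_varFun_eq {I : Type} [Fintype I] [DecidableEq I] {U V ρ σ : Matrix I I ℂ}
    {p q : I → ℝ} (hU : Diagonalizes U p ρ) (hV : Diagonalizes V q σ) (hp : ∀ i, 0 ≤ p i)
    (hq : ∀ i, 0 ≤ q i) {s : ℝ} (hs : 0 < s) (hs1 : s < 1) :
    ∃ X, varFun s X ρ σ = resolventForm (Vᴴ * U) p q s := by
  refine ⟨V * (of fun j i => (Vᴴ * U) j i * ((p i / ((1 - s) * q j + s * p i) : ℝ) : ℂ)) * Uᴴ, ?_⟩
  rw [varFun_eq hU hV, resolventForm]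
  refine Finset.sum_congr rfl fun j _ => Finset.sum_congr rfl fun i _ => ?_
  rw [of_apply]
  generalize (Vᴴ * U) j i = w
  have hq' : 0 ≤ (1 - s) * q j := mul_nonneg (by linarith) (hq j)
  have hp' : 0 ≤ s * p i := mul_nonneg hs.le (hp i)
  rcases (add_nonneg hq' hp').eq_or_lt with h | h
  · have : p i = 0 := by
      have : s * p i = 0 := by linarith
      simpa [hs.ne'] using this
    rw [← h, this]; simp
  · set c := (1 - s) * q j + s * p i
    simp only [Complex.normSq_apply, Complex.star_def, Complex.mul_re, Complex.conj_re,
      Complex.conj_im, Complex.mul_im, Complex.ofReal_re, Complex.ofReal_im]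
    field_simp
    ring

lemma hasDerivAt_mul_log_segment {c p q : ℝ} (h : c = 0 ∨ 0 < p ∧ 0 < q)
    {s : ℝ} (hs : 0 ≤ s) (hs1 : s ≤ 1) :
    HasDerivAt (fun s => c * Real.log ((1 - s) * q + s * p))
      (c * ((p - q) / ((1 - s) * q + s * p))) s := by
  rcases h with rfl | ⟨hp, hq⟩
  · simpa using hasDerivAt_const s (0 : ℝ)
  · have hpos : 0 < (1 - s) * q + s * p := by
      rcases hs.eq_or_lt with rfl | hs
      · simpa using hq
      · have := mul_pos hs hp
        have := mul_nonneg (sub_nonneg.2 hs1) hq.le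
        linarith
    have h1 : HasDerivAt (fun s => (1 - s) * q + s * p) (p - q) s := by
      have := (((hasDerivAt_id' s).const_sub 1).mul_const q).fun_add
        ((hasDerivAt_id' s).mul_const p)
      exact this.congr_deriv (by ring)
    exact (h1.log (ne_of_gt hpos)).const_mul c

/-- Relative entropy `tr ρ (log ρ - log σ)` in terms of spectral data. -/
def spectralRelEntropy {I : Type} [Fintype I] (W : Matrix I I ℂ) (p q : I → ℝ) : ℝ :=
  ∑ j, ∑ i, Complex.normSq (W j i) * p i * (Real.log (p i) - Real.log (q j))

/-- Data processing for the relative entropy: `ι` is the dual of the channel. -/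
theorem spectralRelEntropy_mono {I J : Type} [Fintype I] [DecidableEq I] [Fintype J]
    [DecidableEq J] {U V ρ σ : Matrix I I ℂ} {p q : I → ℝ} {U' V' ρ' σ' : Matrix J J ℂ}
    {p' q' : J → ℝ}
    (hU : Diagonalizes U p ρ) (hV : Diagonalizes V q σ) (hp : ∀ i, 0 ≤ p i) (hq : ∀ i, 0 ≤ q i)
    (hU' : Diagonalizes U' p' ρ') (hV' : Diagonalizes V' q' σ') (hp' : ∀ i, 0 ≤ p' i)
    (hq' : ∀ i, 0 ≤ q' i)
    (hsum : ∑ j, ∑ i, Complex.normSq ((Vᴴ * U) j i) * p i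
      = ∑ j, ∑ i, Complex.normSq ((V'ᴴ * U') j i) * p' i)
    (hsupp : ∀ j i, Complex.normSq ((Vᴴ * U) j i) * p i = 0 ∨ 0 < p i ∧ 0 < q j)
    (hsupp' : ∀ j i, Complex.normSq ((V'ᴴ * U') j i) * p' i = 0 ∨ 0 < p' i ∧ 0 < q' j)
    (ι : Matrix J J ℂ → Matrix I I ℂ) (hstar : ∀ X, ι Xᴴ = (ι X)ᴴ)
    (hmul : ∀ X Y, ι (X * Y) = ι X * ι Y)
    (hρ : ∀ X, trace (ι X * ρ) = trace (X * ρ')) (hσ : ∀ X, trace (ι X * σ) = trace (X * σ')) :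
    spectralRelEntropy (V'ᴴ * U') p' q' ≤ spectralRelEntropy (Vᴴ * U) p q := by
  have key : ∀ s : ℝ, 0 < s → s < 1 →
      resolventForm (V'ᴴ * U') p' q' s ≤ resolventForm (Vᴴ * U) p q s := by
    intro s hs hs1
    obtain ⟨X, hX⟩ := exists_varFun_eq hU' hV' hp' hq' hs hs1
    rw [← hX]
    refine le_trans (le_of_eq ?_) (varFun_le hU hV hp hq hs hs1 (ι X))
    simp only [varFun, ← hstar, ← hmul, hρ, hσ]
  generalize Vᴴ * U = W at *
  generalize V'ᴴ * U' = W' at *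
  have aux : ∀ {K : Type} [Fintype K] (W : Matrix K K ℂ) (p q : K → ℝ),
      (∀ j i, Complex.normSq (W j i) * p i = 0 ∨ 0 < p i ∧ 0 < q j) →
      ∀ s : ℝ, 0 < s → s < 1 →
      ∑ j, ∑ i, Complex.normSq (W j i) * p i * ((p i - q j) / ((1 - s) * q j + s * p i))
        = (resolventForm W p q s - ∑ j, ∑ i, Complex.normSq (W j i) * p i) / (1 - s) := by
    intro K _ W p q hsupp s hs hs1
    rw [resolventForm]
    simp only [← Finset.sum_sub_distrib, Finset.sum_div]
    refine Finset.sum_congr rfl fun j _ => Finset.sum_congr rfl fun i _ => ?_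
    have h1 : 1 - s ≠ 0 := by linarith
    rcases hsupp j i with h | ⟨h, h'⟩
    · have : Complex.normSq (W j i) * (p i ^ 2 / ((1 - s) * q j + s * p i))
          = Complex.normSq (W j i) * p i * (p i / ((1 - s) * q j + s * p i)) := by ring
      rw [this, h]; simp
    · have : (1 - s) * q j + s * p i ≠ 0 :=
        (add_pos (mul_pos (by linarith) h') (mul_pos hs h)).ne'
      rw [eq_div_iff h1]
      have hd : (1 - s) * q j = (1 - s) * q j + s * p i - s * p i := by ring
      generalize (1 - s) * q j + s * p i = d at *
      field_simp
      linear_combination (-Complex.normSq (W j i)) * hd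
  let F : ℝ → ℝ := fun s =>
    ∑ j, ∑ i, Complex.normSq (W j i) * p i * Real.log ((1 - s) * q j + s * p i)
    - ∑ j, ∑ i, Complex.normSq (W' j i) * p' i * Real.log ((1 - s) * q' j + s * p' i)
  have hF : ∀ s : ℝ, 0 ≤ s → s ≤ 1 → HasDerivAt F
      (∑ j, ∑ i, Complex.normSq (W j i) * p i * ((p i - q j) / ((1 - s) * q j + s * p i))
      - ∑ j, ∑ i, Complex.normSq (W' j i) * p' i *
        ((p' i - q' j) / ((1 - s) * q' j + s * p' i))) s := by
    intro s hs hs1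
    refine HasDerivAt.sub ?_ ?_
    · exact HasDerivAt.fun_sum fun j _ => HasDerivAt.fun_sum fun i _ =>
        hasDerivAt_mul_log_segment (hsupp j i) hs hs1
    · exact HasDerivAt.fun_sum fun j _ => HasDerivAt.fun_sum fun i _ =>
        hasDerivAt_mul_log_segment (hsupp' j i) hs hs1
  have hmono : MonotoneOn F (Set.Icc 0 1) := by
    refine monotoneOn_of_deriv_nonneg (convex_Icc 0 1)
      (fun s hs => (hF s hs.1 hs.2).continuousAt.continuousWithinAt) ?_ ?_
    · intro s hs
      rw [interior_Icc] at hs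
      exact (hF s hs.1.le hs.2.le).differentiableAt.differentiableWithinAt
    · intro s hs
      rw [interior_Icc] at hs
      rw [(hF s hs.1.le hs.2.le).deriv, aux W p q hsupp s hs.1 hs.2,
        aux W' p' q' hsupp' s hs.1 hs.2, hsum, ← sub_div]
      refine div_nonneg ?_ (by linarith [hs.2])
      linarith [key s hs.1 hs.2]
  have h01 := hmono (Set.left_mem_Icc.2 zero_le_one) (Set.right_mem_Icc.2 zero_le_one) zero_le_one
  simp only [F, sub_zero, one_mul, zero_mul, add_zero, sub_self, zero_add] at h01
  simp only [spectralRelEntropy, mul_sub, Finset.sum_sub_distrib]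
  linarith

lemma matEntropy_eq {I : Type} [Fintype I] [DecidableEq I] {ρ : Matrix I I ℂ}
    (h : ρ.IsHermitian) : matEntropy ρ = ∑ i, Real.negMulLog (h.eigenvalues i) := dif_pos h

lemma diagonalizes_eigenvalues {I : Type} [Fintype I] [DecidableEq I] {ρ : Matrix I I ℂ}
    (h : ρ.IsHermitian) :
    Diagonalizes (h.eigenvectorUnitary : Matrix I I ℂ) h.eigenvalues ρ where
  mul_conj := Unitary.coe_mul_star_self _
  conj_mul := Unitary.coe_star_mul_self _
  eq := by
    conv_lhs => rw [h.spectral_theorem, Unitary.conjStarAlgAut_apply]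
    rfl

lemma matEntropy_submatrix {I J : Type} [Fintype I] [DecidableEq I] [Fintype J] [DecidableEq J]
    (e : J ≃ I) {ρ : Matrix I I ℂ} (h : ρ.IsHermitian) :
    matEntropy (ρ.submatrix e e) = matEntropy ρ := by
  have h' : (ρ.submatrix e e).IsHermitian := h.submatrix e
  have key : ∀ {K : Type} [Fintype K] [DecidableEq K] {τ : Matrix K K ℂ} (hτ : τ.IsHermitian),
      matEntropy τ = (τ.charpoly.roots.map fun z => Real.negMulLog z.re).sum := by
    intro K _ _ τ hτ
    rw [matEntropy_eq hτ, hτ.roots_charpoly_eq_eigenvalues, Multiset.map_map]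
    rfl
  rw [key h, key h', show ρ.submatrix e e = reindex e.symm e.symm ρ from rfl, charpoly_reindex]

lemma sum_eigenvalues_eq_one {I : Type} [Fintype I] [DecidableEq I] {ρ : Matrix I I ℂ}
    (hρ : IsDensityMatrix ρ) : ∑ i, hρ.1.isHermitian.eigenvalues i = 1 := by
  have := hρ.1.isHermitian.trace_eq_sum_eigenvalues
  exact Complex.ofReal_injective (by push_cast; exact this.symm.trans hρ.2)

lemma matEntropy_nonneg {I : Type} [Fintype I] [DecidableEq I] {ρ : Matrix I I ℂ}
    (hρ : IsDensityMatrix ρ) : 0 ≤ matEntropy ρ := by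
  rw [matEntropy_eq hρ.1.isHermitian]
  refine Finset.sum_nonneg fun i _ => Real.negMulLog_nonneg (hρ.1.eigenvalues_nonneg i) ?_
  rw [← sum_eigenvalues_eq_one hρ]
  exact Finset.single_le_sum (f := hρ.1.isHermitian.eigenvalues)
    (fun i _ => hρ.1.eigenvalues_nonneg i) (Finset.mem_univ i)

/-- Partial trace over the first factor. -/
def traceLeft {A B : Type} [Fintype A] (ρ : Matrix (A × B) (A × B) ℂ) : Matrix B B ℂ :=
  of fun x y => ∑ a, ρ (a, x) (a, y)

/-- Partial trace over the last of three factors. -/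
def traceLast {A B C : Type} [Fintype C] (ρ : Matrix (A × B × C) (A × B × C) ℂ) :
    Matrix (A × B) (A × B) ℂ :=
  of fun x y => ∑ c, ρ (x.1, x.2, c) (y.1, y.2, c)

lemma sum_posSemidef {K : Type} [Fintype K] {I : Type} {f : K → Matrix I I ℂ}
    (h : ∀ k, (f k).PosSemidef) : (of fun x y => ∑ k, f k x y : Matrix I I ℂ).PosSemidef := by
  have : (of fun x y => ∑ k, f k x y : Matrix I I ℂ) = ∑ k, f k := by
    ext x y; simp [Matrix.sum_apply]
  rw [this]
  exact posSemidef_sum _ fun k _ => h k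

lemma IsDensityMatrix.traceLeft {A B : Type} [Fintype A] [Fintype B]
    {ρ : Matrix (A × B) (A × B) ℂ} (hρ : IsDensityMatrix ρ) : IsDensityMatrix (traceLeft ρ) := by
  refine ⟨sum_posSemidef (f := fun a => ρ.submatrix (fun x => (a, x)) (fun x => (a, x)))
    fun a => hρ.1.submatrix _, ?_⟩
  rw [← hρ.2]
  simp only [trace, diag_apply, Fintype.sum_prod_type, _root_.traceLeft, of_apply]
  exact Finset.sum_comm

lemma IsDensityMatrix.traceLast {A B C : Type} [Fintype A] [Fintype B] [Fintype C]
    {ρ : Matrix (A × B × C) (A × B × C) ℂ} (hρ : IsDensityMatrix ρ) :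
    IsDensityMatrix (traceLast ρ) := by
  refine ⟨sum_posSemidef
    (f := fun c => ρ.submatrix (fun x : A × B => (x.1, x.2, c)) (fun x => (x.1, x.2, c)))
    fun c => hρ.1.submatrix _, ?_⟩
  rw [← hρ.2]
  simp only [trace, diag_apply, Fintype.sum_prod_type, _root_.traceLast, of_apply]

open scoped Kronecker

lemma Diagonalizes.one_kronecker {A B : Type} [Fintype A] [DecidableEq A] [Fintype B]
    [DecidableEq B] {V τ : Matrix B B ℂ} {q : B → ℝ} (hV : Diagonalizes V q τ) :
    Diagonalizes ((1 : Matrix A A ℂ) ⊗ₖ V) (fun x => q x.2) ((1 : Matrix A A ℂ) ⊗ₖ τ) where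
  mul_conj := by
    rw [conjTranspose_kronecker, ← mul_kronecker_mul, hV.mul_conj]; simp
  conj_mul := by
    rw [conjTranspose_kronecker, ← mul_kronecker_mul, hV.conj_mul]; simp
  eq := by
    have : diagonal (fun x : A × B => (q x.2 : ℂ))
        = (1 : Matrix A A ℂ) ⊗ₖ diagonal (fun i => (q i : ℂ)) := by
      rw [← diagonal_one, diagonal_kronecker_diagonal]; simp
    rw [this, conjTranspose_kronecker, ← mul_kronecker_mul, ← mul_kronecker_mul, ← hV.eq]
    simp

lemma Diagonalizes.sum_normSq_left {I : Type} [Fintype I] [DecidableEq I] {U V ρ σ : Matrix I I ℂ}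
    {p q : I → ℝ} (hU : Diagonalizes U p ρ) (hV : Diagonalizes V q σ) (i : I) :
    ∑ j, Complex.normSq ((Vᴴ * U) j i) = 1 := by
  have h : (Vᴴ * U)ᴴ * (Vᴴ * U) = 1 := by
    rw [conjTranspose_mul, conjTranspose_conjTranspose, Matrix.mul_assoc, ← Matrix.mul_assoc V,
      hV.mul_conj, Matrix.one_mul, hU.conj_mul]
  have := congrFun (congrFun h i) i
  rw [mul_apply, one_apply_eq] at this
  simp only [conjTranspose_apply, Complex.star_def, ← Complex.normSq_eq_conj_mul_self] at this
  exact_mod_cast this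

lemma Diagonalizes.sum_normSq_mul {I : Type} [Fintype I] [DecidableEq I] {U ρ : Matrix I I ℂ}
    {p : I → ℝ} (hU : Diagonalizes U p ρ) (V : Matrix I I ℂ) (j : I) :
    ((∑ i, Complex.normSq ((Vᴴ * U) j i) * p i : ℝ) : ℂ) = (Vᴴ * ρ * V) j j := by
  have : Vᴴ * ρ * V = Vᴴ * U * diagonal (fun i => (p i : ℂ)) * (Vᴴ * U)ᴴ := by
    rw [hU.eq, conjTranspose_mul, conjTranspose_conjTranspose]
    simp only [Matrix.mul_assoc]
  rw [this, mul_apply]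
  push_cast
  refine Finset.sum_congr rfl fun i _ => ?_
  rw [mul_diagonal, conjTranspose_apply, Complex.star_def, Complex.normSq_eq_conj_mul_self]
  ring

lemma Diagonalizes.conj_eq {I : Type} [Fintype I] [DecidableEq I] {U ρ : Matrix I I ℂ}
    {p : I → ℝ} (hU : Diagonalizes U p ρ) : Uᴴ * ρ * U = diagonal (fun i => (p i : ℂ)) := by
  rw [hU.eq, Matrix.mul_assoc, Matrix.mul_assoc, Matrix.mul_assoc, hU.conj_mul, Matrix.mul_one,
    ← Matrix.mul_assoc, hU.conj_mul, Matrix.one_mul]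

lemma traceLeft_conj {A B : Type} [Fintype A] [DecidableEq A] [Fintype B]
    (V : Matrix B B ℂ) (ρ : Matrix (A × B) (A × B) ℂ) :
    traceLeft (((1 : Matrix A A ℂ) ⊗ₖ V)ᴴ * ρ * ((1 : Matrix A A ℂ) ⊗ₖ V))
      = Vᴴ * traceLeft ρ * V := by
  ext x y
  simp only [traceLeft, of_apply, mul_apply, conjTranspose_apply, Fintype.sum_prod_type,
    kroneckerMap_apply, one_apply, ite_mul, one_mul, zero_mul, mul_ite, mul_zero,
    Finset.sum_ite_eq', Finset.mem_univ, if_true, Finset.sum_mul,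
    Finset.mul_sum, apply_ite (star : ℂ → ℂ), star_zero, Finset.sum_ite_irrel,
    Finset.sum_const_zero]
  rw [Finset.sum_comm]
  refine Finset.sum_congr rfl fun b _ => ?_
  rw [Finset.sum_comm]

/-- For `ρ` on `A × B` and spectral data of its marginal on `B`, the weights sum to the marginal
spectrum. -/
lemma sum_normSq_mul_marginal {A B : Type} [Fintype A] [DecidableEq A] [Fintype B] [DecidableEq B]
    {U ρ : Matrix (A × B) (A × B) ℂ} {p : A × B → ℝ} {V : Matrix B B ℂ} {q : B → ℝ}
    (hU : Diagonalizes U p ρ) (hV : Diagonalizes V q (traceLeft ρ)) (b : B) :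
    ∑ a, ∑ i, Complex.normSq ((((1 : Matrix A A ℂ) ⊗ₖ V)ᴴ * U) (a, b) i) * p i = q b := by
  have h := congrFun (congrFun (traceLeft_conj V ρ) b) b
  rw [hV.conj_eq, diagonal_apply_eq] at h
  simp only [traceLeft, of_apply, ← hU.sum_normSq_mul] at h
  exact_mod_cast h

lemma sum_sum_normSq_mul_marginal {A B : Type} [Fintype A] [DecidableEq A] [Fintype B]
    [DecidableEq B] {U ρ : Matrix (A × B) (A × B) ℂ} {p : A × B → ℝ} {V : Matrix B B ℂ}
    {q : B → ℝ} (hU : Diagonalizes U p ρ) (hV : Diagonalizes V q (traceLeft ρ)) :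
    ∑ j, ∑ i, Complex.normSq ((((1 : Matrix A A ℂ) ⊗ₖ V)ᴴ * U) j i) * p i = ∑ b, q b := by
  rw [Fintype.sum_prod_type, Finset.sum_comm]
  exact Finset.sum_congr rfl fun b _ => sum_normSq_mul_marginal hU hV b

lemma marginal_support {A B : Type} [Fintype A] [DecidableEq A] [Fintype B] [DecidableEq B]
    {U ρ : Matrix (A × B) (A × B) ℂ} {p : A × B → ℝ} {V : Matrix B B ℂ} {q : B → ℝ}
    (hU : Diagonalizes U p ρ) (hV : Diagonalizes V q (traceLeft ρ)) (hp : ∀ i, 0 ≤ p i)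
    (hq : ∀ i, 0 ≤ q i) (j i : A × B) :
    Complex.normSq ((((1 : Matrix A A ℂ) ⊗ₖ V)ᴴ * U) j i) * p i = 0 ∨ 0 < p i ∧ 0 < q j.2 := by
  have hnn : ∀ j i, 0 ≤ Complex.normSq ((((1 : Matrix A A ℂ) ⊗ₖ V)ᴴ * U) j i) * p i :=
    fun j i => mul_nonneg (Complex.normSq_nonneg _) (hp i)
  rcases (hp i).eq_or_lt with h | h
  · left; rw [← h, mul_zero]
  rcases (hq j.2).eq_or_lt with h' | h'
  · left
    have hs := sum_normSq_mul_marginal hU hV j.2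
    rw [← h', Finset.sum_eq_zero_iff_of_nonneg
      fun a _ => Finset.sum_nonneg fun i _ => hnn _ i] at hs
    have := hs j.1 (Finset.mem_univ _)
    rw [Finset.sum_eq_zero_iff_of_nonneg fun i _ => hnn _ i] at this
    exact this i (Finset.mem_univ _)
  · exact Or.inr ⟨h, h'⟩

lemma spectralRelEntropy_marginal {A B : Type} [Fintype A] [DecidableEq A] [Fintype B]
    [DecidableEq B] {U ρ : Matrix (A × B) (A × B) ℂ} {p : A × B → ℝ} {V : Matrix B B ℂ}
    {q : B → ℝ} (hU : Diagonalizes U p ρ) (hV : Diagonalizes V q (traceLeft ρ)) :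
    spectralRelEntropy (((1 : Matrix A A ℂ) ⊗ₖ V)ᴴ * U) p (fun x => q x.2)
      = ∑ b, Real.negMulLog (q b) - ∑ i, Real.negMulLog (p i) := by
  simp only [spectralRelEntropy, mul_sub, Finset.sum_sub_distrib]
  have h1 : ∑ j, ∑ i, Complex.normSq ((((1 : Matrix A A ℂ) ⊗ₖ V)ᴴ * U) j i) * p i * Real.log (p i)
      = - ∑ i, Real.negMulLog (p i) := by
    rw [Finset.sum_comm, ← Finset.sum_neg_distrib]
    refine Finset.sum_congr rfl fun i _ => ?_
    rw [← Finset.sum_mul, ← Finset.sum_mul, hU.sum_normSq_left hV.one_kronecker, Real.negMulLog]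
    ring
  have h2 : ∑ j : A × B, ∑ i, Complex.normSq ((((1 : Matrix A A ℂ) ⊗ₖ V)ᴴ * U) j i) * p i
      * Real.log (q j.2) = - ∑ b, Real.negMulLog (q b) := by
    rw [Fintype.sum_prod_type, Finset.sum_comm, ← Finset.sum_neg_distrib]
    refine Finset.sum_congr rfl fun b _ => ?_
    simp only [← Finset.sum_mul]
    rw [sum_normSq_mul_marginal hU hV, Real.negMulLog]
    ring
  rw [h1, h2]
  ring

/-- The embedding `X ↦ X ⊗ 1` dual to `traceLast`. -/
def embedLast {A B : Type} (C : Type) [DecidableEq C] (X : Matrix (A × B) (A × B) ℂ) :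
    Matrix (A × B × C) (A × B × C) ℂ :=
  of fun x y => X (x.1, x.2.1) (y.1, y.2.1) * if x.2.2 = y.2.2 then 1 else 0

lemma trace_embedLast_mul {A B C : Type} [Fintype A] [Fintype B] [Fintype C] [DecidableEq C]
    (X : Matrix (A × B) (A × B) ℂ) (ρ : Matrix (A × B × C) (A × B × C) ℂ) :
    trace (embedLast C X * ρ) = trace (X * traceLast ρ) := by
  simp only [trace, diag_apply, mul_apply, embedLast, of_apply, Fintype.sum_prod_type, mul_ite,
    mul_one, mul_zero, ite_mul, zero_mul, Finset.sum_ite_eq, Finset.mem_univ, if_true, traceLast,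
    Finset.mul_sum]
  refine Finset.sum_congr rfl fun a _ => Finset.sum_congr rfl fun b _ => ?_
  rw [Finset.sum_comm]
  refine Finset.sum_congr rfl fun a _ => ?_
  rw [Finset.sum_comm]

/-- Strong subadditivity of the von Neumann entropy. -/
theorem strong_subadditivity {A B C : Type} [Fintype A] [DecidableEq A] [Fintype B]
    [DecidableEq B] [Fintype C] [DecidableEq C] {ρ : Matrix (A × B × C) (A × B × C) ℂ}
    (hρ : IsDensityMatrix ρ) :
    matEntropy (traceLeft (traceLast ρ)) + matEntropy ρ
      ≤ matEntropy (traceLast ρ) + matEntropy (traceLeft ρ) := by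
  have hBC := hρ.traceLeft
  have hAB := hρ.traceLast
  have hB := hAB.traceLeft
  have dρ := diagonalizes_eigenvalues hρ.1.isHermitian
  have dBC := diagonalizes_eigenvalues hBC.1.isHermitian
  have dAB := diagonalizes_eigenvalues hAB.1.isHermitian
  have dB := diagonalizes_eigenvalues hB.1.isHermitian
  have h := spectralRelEntropy_mono dρ (dBC.one_kronecker (A := A)) hρ.1.eigenvalues_nonneg
    (fun x => hBC.1.eigenvalues_nonneg x.2) dAB (dB.one_kronecker (A := A))
    hAB.1.eigenvalues_nonneg (fun x => hB.1.eigenvalues_nonneg x.2) ?_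
    (marginal_support dρ dBC hρ.1.eigenvalues_nonneg hBC.1.eigenvalues_nonneg)
    (marginal_support dAB dB hAB.1.eigenvalues_nonneg hB.1.eigenvalues_nonneg)
    (embedLast C) ?_ ?_ (fun X => trace_embedLast_mul X ρ) ?_
  · rw [spectralRelEntropy_marginal dρ dBC, spectralRelEntropy_marginal dAB dB] at h
    rw [matEntropy_eq hρ.1.isHermitian, matEntropy_eq hBC.1.isHermitian,
      matEntropy_eq hAB.1.isHermitian, matEntropy_eq hB.1.isHermitian]
    linarith
  · exact (sum_sum_normSq_mul_marginal dρ dBC).trans ((sum_eigenvalues_eq_one hBC).trans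
      ((sum_eigenvalues_eq_one hB).symm.trans (sum_sum_normSq_mul_marginal dAB dB).symm))
  · intro X
    ext x y
    simp only [embedLast, of_apply, conjTranspose_apply, star_mul']
    congr 1
    by_cases h : x.2.2 = y.2.2 <;> simp [h, eq_comm]
  · intro X Y
    ext x y
    simp only [embedLast, mul_apply, of_apply, Fintype.sum_prod_type, mul_ite, mul_one, mul_zero,
      ite_mul, zero_mul]
    by_cases h : x.2.2 = y.2.2 <;> simp [h]
  · intro X
    rw [trace_embedLast_mul]
    congr 2
    ext x y
    simp only [traceLast, traceLeft, of_apply, kroneckerMap_apply, Finset.mul_sum]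
    rw [Finset.sum_comm]

/-- Dependent functions on a disjoint union of subtypes. -/
def piJoin {κ : Type} {α : κ → Type} {p q r : κ → Prop} [DecidablePred p]
    (hr : ∀ i, r i ↔ p i ∨ q i) (hd : ∀ i, p i → ¬ q i) :
    (∀ i : {j // p j}, α i.1) × (∀ i : {j // q j}, α i.1) ≃ ∀ i : {j // r j}, α i.1 where
  toFun x i := if h : p i.1 then x.1 ⟨i.1, h⟩ else x.2 ⟨i.1, ((hr i.1).1 i.2).resolve_left h⟩
  invFun f := (fun i => f ⟨i.1, (hr i.1).2 (Or.inl i.2)⟩, fun i => f ⟨i.1, (hr i.1).2 (Or.inr i.2)⟩)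
  left_inv x := by
    ext i
    · simp [i.2]
    · have : ¬ p i.1 := fun h => hd _ h i.2
      simp [this]
  right_inv f := by
    ext i
    by_cases h : p i.1 <;> simp [h]

section Reduce

variable {κ : Type} [Fintype κ] [DecidableEq κ] {α : κ → Type} [∀ i, Fintype (α i)]
  {ρ : Matrix (∀ i, α i) (∀ i, α i) ℂ}

lemma reduce_posSemidef (hρ : ρ.PosSemidef) (s : Finset κ) : (reduce s ρ).PosSemidef :=
  sum_posSemidef (f := fun h : ∀ i : {j // j ∉ s}, α i.1 =>
    ρ.submatrix (fun f : ∀ i : {j // j ∈ s}, α i.1 =>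
        fun i => if hi : i ∈ s then f ⟨i, hi⟩ else h ⟨i, hi⟩)
      (fun f : ∀ i : {j // j ∈ s}, α i.1 => fun i => if hi : i ∈ s then f ⟨i, hi⟩ else h ⟨i, hi⟩))
    fun _ => hρ.submatrix _

lemma IsDensityMatrix.reduce (hρ : IsDensityMatrix ρ) (s : Finset κ) :
    IsDensityMatrix (reduce s ρ) := by
  refine ⟨reduce_posSemidef hρ.1 s, ?_⟩
  rw [← hρ.2, trace, trace, ← (Equiv.piEquivPiSubtypeProd (· ∈ s) α).symm.sum_comp,
    Fintype.sum_prod_type]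
  rfl

lemma matEntropy_reduce_univ [∀ i, DecidableEq (α i)] (hρ : ρ.PosSemidef) :
    matEntropy (reduce Finset.univ ρ) = matEntropy ρ := by
  let e : (∀ i, α i) ≃ (∀ i : {j // j ∈ (Finset.univ : Finset κ)}, α i.1) :=
    { toFun := fun f i => f i.1
      invFun := fun f i => f ⟨i, Finset.mem_univ i⟩
      left_inv := fun _ => rfl
      right_inv := fun _ => rfl }
  rw [← matEntropy_submatrix e (reduce_posSemidef hρ _).isHermitian]
  congr 1
  ext f g
  have : IsEmpty {j // j ∉ (Finset.univ : Finset κ)} := ⟨fun i => i.2 (Finset.mem_univ _)⟩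
  simp [reduce, e]

/-- Strong subadditivity for three disjoint collections of subsystems. -/
theorem matEntropy_reduce_strong_subadditivity [∀ i, DecidableEq (α i)] (hρ : IsDensityMatrix ρ)
    {s t u : Finset κ} (hst : Disjoint s t) (hsu : Disjoint s u) (htu : Disjoint t u) :
    matEntropy (reduce t ρ) + matEntropy (reduce (s ∪ t ∪ u) ρ)
      ≤ matEntropy (reduce (s ∪ t) ρ) + matEntropy (reduce (t ∪ u) ρ) := by
  rw [Finset.disjoint_left] at hst hsu htu
  let w := s ∪ t ∪ u
  let G : (∀ i : {j // j ∈ s}, α i.1) × (∀ i : {j // j ∈ t}, α i.1) × (∀ i : {j // j ∈ u}, α i.1) →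
      (∀ i : {j // j ∉ w}, α i.1) → ∀ i, α i := fun x d i =>
    if hs : i ∈ s then x.1 ⟨i, hs⟩ else if ht : i ∈ t then x.2.1 ⟨i, ht⟩ else
      if hu : i ∈ u then x.2.2 ⟨i, hu⟩ else d ⟨i, by simp [w, hs, ht, hu]⟩
  let est : _ ≃ (∀ i : {j // j ∈ s ∪ t}, α i.1) :=
    piJoin (α := α) (p := (· ∈ s)) (q := (· ∈ t)) (fun i => Finset.mem_union) (fun i => @hst i)
  let etu : _ ≃ (∀ i : {j // j ∈ t ∪ u}, α i.1) :=
    piJoin (α := α) (p := (· ∈ t)) (q := (· ∈ u)) (fun i => Finset.mem_union) (fun i => @htu i)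
  let ew : _ ≃ (∀ i : {j // j ∈ w}, α i.1) := (Equiv.prodCongrRight fun _ => etu).trans <|
    piJoin (α := α) (p := (· ∈ s)) (q := (· ∈ t ∪ u)) (fun i => by simp [w])
      (fun i h => by simp [hst h, hsu h])
  let M := (reduce w ρ).submatrix ew ew
  have hM : ∀ x y, M x y = ∑ d, ρ (G x d) (G y d) := by
    intro x y
    refine Finset.sum_congr rfl fun d _ => ?_
    congr 1 <;>
    · funext i
      by_cases hs : i ∈ s <;> by_cases ht : i ∈ t <;> by_cases hu : i ∈ u <;>
        simp [G, w, ew, etu, piJoin, hs, ht, hu]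
  have hMd : IsDensityMatrix M := by
    refine ⟨(hρ.reduce w).1.submatrix ew, ?_⟩
    rw [← (hρ.reduce w).2]
    exact ew.sum_comp fun i => reduce w ρ i i
  have hst' : (reduce (s ∪ t) ρ).submatrix est est = traceLast M := by
    ext x y
    let r : _ ≃ (∀ i : {j // j ∉ s ∪ t}, α i.1) := piJoin (α := α) (p := (· ∈ u)) (q := (· ∉ w))
      (fun i => by
        have h1 := @hsu i
        have h2 := @htu i
        simp only [w, Finset.mem_union]; tauto) (fun i h => by simp [w, h])
    simp only [traceLast, of_apply, hM, submatrix_apply, reduce]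
    rw [← r.sum_comp, Fintype.sum_prod_type]
    refine Finset.sum_congr rfl fun c _ => Finset.sum_congr rfl fun d _ => ?_
    congr 1 <;>
    · funext i
      by_cases hs : i ∈ s <;> by_cases ht : i ∈ t <;> by_cases hu : i ∈ u <;>
        simp [G, est, r, piJoin, hs, ht, hu]
  have htu' : (reduce (t ∪ u) ρ).submatrix etu etu = traceLeft M := by
    ext x y
    let r : _ ≃ (∀ i : {j // j ∉ t ∪ u}, α i.1) := piJoin (α := α) (p := (· ∈ s)) (q := (· ∉ w))
      (fun i => by
        have h1 := @hst i
        have h2 := @hsu i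
        simp only [w, Finset.mem_union]; tauto) (fun i h => by simp [w, h])
    simp only [traceLeft, of_apply, hM, submatrix_apply, reduce]
    rw [← r.sum_comp, Fintype.sum_prod_type]
    refine Finset.sum_congr rfl fun c _ => Finset.sum_congr rfl fun d _ => ?_
    congr 1 <;>
    · funext i
      have h1 := @hst i
      have h2 := @hsu i
      by_cases hs : i ∈ s <;> by_cases ht : i ∈ t <;> by_cases hu : i ∈ u <;>
        first
        | exact absurd ht (h1 hs)
        | exact absurd hu (h2 hs)
        | simp [G, etu, r, piJoin, hs, ht, hu]
  have ht' : reduce t ρ = traceLeft (traceLast M) := by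
    ext x y
    let r : _ ≃ (∀ i : {j // j ∉ t}, α i.1) := (Equiv.prodCongrRight fun _ =>
        (piJoin (α := α) (p := (· ∈ u)) (q := (· ∉ w)) (r := (· ∉ s ∪ t))
          (fun i => by
            have h1 := @hsu i
            have h2 := @htu i
            simp only [w, Finset.mem_union]; tauto) (fun i h => by simp [w, h]))).trans <|
      piJoin (α := α) (p := (· ∈ s)) (q := (· ∉ s ∪ t)) (fun i => by
        have h1 := @hst i
        simp only [Finset.mem_union]; tauto) (fun i h => by simp [h])
    simp only [traceLeft, traceLast, of_apply, hM, reduce]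
    rw [← r.sum_comp, Fintype.sum_prod_type]
    refine Finset.sum_congr rfl fun a _ => ?_
    rw [Fintype.sum_prod_type]
    refine Finset.sum_congr rfl fun c _ => Finset.sum_congr rfl fun d _ => ?_
    congr 1 <;>
    · funext i
      have h1 := @hst i
      by_cases hs : i ∈ s <;> by_cases ht : i ∈ t <;> by_cases hu : i ∈ u <;>
        first
        | exact absurd ht (h1 hs)
        | simp [G, r, piJoin, hs, ht, hu]
  have h := strong_subadditivity hMd
  rw [← ht', ← hst', ← htu'] at h
  have hH := fun v => (hρ.reduce v).1.isHermitian
  rwa [matEntropy_submatrix ew (hH w), matEntropy_submatrix est (hH _),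
    matEntropy_submatrix etu (hH _)] at h

end Reduce

section Purification

variable {κ π : Type} [Fintype κ] [DecidableEq κ] [Fintype π] [DecidableEq π] {α : κ → Type}
  [∀ i, Fintype (α i)] {d : π → ℕ}

/-- Assignments on all systems are pairs of assignments on the originals and the ancillas. -/
def mergeSumEquiv {κ π : Type} (α : κ → Type) (δ : π → Type) :
    ((∀ i, α i) × ∀ k, δ k) ≃ ∀ i : κ ⊕ π, Sum.elim α δ i where
  toFun x := mergeSum x.1 x.2
  invFun f := (fun i => f (.inl i), fun k => f (.inr k))
  left_inv _ := rfl
  right_inv f := by funext i; cases i <;> rfl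

lemma Purifies.isDensityMatrix
    {ψ : (∀ i : κ ⊕ π, Sum.elim α (fun k => Fin (d k)) i) → ℂ}
    {ρ : Matrix (∀ i, α i) (∀ i, α i) ℂ} (h : Purifies ψ ρ) (hρ : ρ.trace = 1) :
    IsDensityMatrix (vecState ψ) := by
  refine ⟨posSemidef_vecMulVec_self_star ψ, ?_⟩
  rw [← hρ, trace, ← (mergeSumEquiv α fun k => Fin (d k)).sum_comp, Fintype.sum_prod_type, trace]
  exact Finset.sum_congr rfl fun f _ => h f f

lemma Purifies.matEntropy_reduce_inl [∀ i, DecidableEq (α i)]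
    {ψ : (∀ i : κ ⊕ π, Sum.elim α (fun k => Fin (d k)) i) → ℂ}
    {ρ : Matrix (∀ i, α i) (∀ i, α i) ℂ} (h : Purifies ψ ρ) (hρ : ρ.trace = 1)
    (s : Finset κ) :
    matEntropy (reduce (s.image Sum.inl) (vecState ψ)) = matEntropy (reduce s ρ) := by
  let e : (∀ i : {j // j ∈ s}, α i.1) ≃
      (∀ i : {j : κ ⊕ π // j ∈ s.image Sum.inl}, Sum.elim α (fun k => Fin (d k)) i.1) :=
    { toFun := fun f i => match i with
        | ⟨.inl j, hj⟩ => f ⟨j, by simpa using hj⟩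
        | ⟨.inr j, hj⟩ => absurd hj (by simp)
      invFun := fun f i => f ⟨.inl i.1, by simp⟩
      left_inv := fun f => rfl
      right_inv := fun f => by
        funext ⟨i, hi⟩
        cases i with
        | inl j => rfl
        | inr j => simp at hi }
  let r : ((∀ i : {j // j ∉ s}, α i.1) × (∀ k, Fin (d k))) ≃
      (∀ i : {j : κ ⊕ π // j ∉ s.image Sum.inl}, Sum.elim α (fun k => Fin (d k)) i.1) :=
    { toFun := fun f i => match i with
        | ⟨.inl j, hj⟩ => f.1 ⟨j, by simpa using hj⟩
        | ⟨.inr j, _⟩ => f.2 j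
      invFun := fun f => (fun i => f ⟨.inl i.1, by simpa using i.2⟩, fun k => f ⟨.inr k, by simp⟩)
      left_inv := fun f => rfl
      right_inv := fun f => by
        funext ⟨i, hi⟩
        cases i <;> rfl }
  rw [← matEntropy_submatrix e ((h.isDensityMatrix hρ).reduce _).1.isHermitian]
  congr 1
  ext f g
  simp only [submatrix_apply, reduce, of_apply]
  rw [← r.sum_comp, Fintype.sum_prod_type]
  refine Finset.sum_congr rfl fun x _ => ?_
  rw [← h]
  refine Finset.sum_congr rfl fun y _ => ?_
  congr 1 <;>
  · funext i
    cases i with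
    | inl j =>
      by_cases hj : j ∈ s
      · simp only [Finset.mem_image_of_mem, hj, dite_true, mergeSum]
        rfl
      · simp [r, mergeSum, hj]
    | inr j => simp [r, mergeSum]

lemma exists_purifies [∀ i, DecidableEq (α i)] (p : κ ≃ π)
    {ρ : Matrix (∀ i, α i) (∀ i, α i) ℂ} (hρ : ρ.PosSemidef) :
    ∃ (d : π → ℕ) (ψ : (∀ i : κ ⊕ π, Sum.elim α (fun k => Fin (d k)) i) → ℂ), Purifies ψ ρ := by
  obtain ⟨B, rfl⟩ : ∃ B : Matrix (∀ i, α i) (∀ i, α i) ℂ, ρ = B * Bᴴ := by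
    refine ⟨(hρ.isHermitian.eigenvectorUnitary : Matrix (∀ i, α i) (∀ i, α i) ℂ) *
      diagonal (fun i => (√(hρ.isHermitian.eigenvalues i) : ℂ)), ?_⟩
    conv_lhs => rw [(diagonalizes_eigenvalues hρ.isHermitian).eq]
    rw [conjTranspose_mul, diagonal_conjTranspose, ← Matrix.mul_assoc, Matrix.mul_assoc _ _
      (diagonal _), diagonal_mul_diagonal]
    congr 3
    funext i
    rw [Pi.star_apply, Complex.star_def, Complex.conj_ofReal, ← Complex.ofReal_mul,
      Real.mul_self_sqrt (hρ.eigenvalues_nonneg i)]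
  let e : (∀ i, α i) ≃ ∀ k, Fin (Fintype.card (α (p.symm k))) :=
    (Equiv.piCongrLeft' α p).trans (Equiv.piCongrRight fun k => Fintype.equivFin _)
  refine ⟨fun k => Fintype.card (α (p.symm k)),
    fun x => B (fun i => x (.inl i)) (e.symm fun k => x (.inr k)), fun f g => ?_⟩
  rw [mul_apply, ← e.symm.sum_comp]
  rfl

end Purification

/-- `Δ_P(A:B:C) ≥ Ĩ₃(A:B:C)`, the tripartite information
`S_A+S_B+S_C−S_{AB}−S_{BC}−S_{CA}+S_{ABC}`.
Subsystems `A, B, C` are indexed by `0, 1, 2 : Fin 3`. -/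
theorem DeltaP_ge_tripartite_information {α : Fin 3 → Type}
    [∀ i, Fintype (α i)] [∀ i, DecidableEq (α i)]
    (ρ : Matrix (∀ i, α i) (∀ i, α i) ℂ) (hρ : IsDensityMatrix ρ) :
    matEntropy (reduce {0} ρ) + matEntropy (reduce {1} ρ) + matEntropy (reduce {2} ρ)
      - matEntropy (reduce ({0, 1} : Finset (Fin 3)) ρ)
      - matEntropy (reduce ({1, 2} : Finset (Fin 3)) ρ)
      - matEntropy (reduce ({2, 0} : Finset (Fin 3)) ρ)
      + matEntropy ρ
    ≤ DeltaPart id ρ := by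
  refine le_csInf ?_ ?_
  · obtain ⟨d, ψ, h⟩ := exists_purifies (Equiv.refl (Fin 3)) hρ.1
    exact ⟨_, d, ψ, h, rfl⟩
  rintro _ ⟨d, ψ, h, rfl⟩
  have hψ := h.isDensityMatrix hρ.2
  let S := fun v => matEntropy (reduce v (vecState ψ))
  let R := fun v => matEntropy (reduce v ρ)
  have hS : ∀ v, 0 ≤ S v := fun v => matEntropy_nonneg (hψ.reduce v)
  have hSR : ∀ v, S (v.image Sum.inl) = R v := h.matEntropy_reduce_inl hρ.2
  have h0 : R {2} + R ({0} ∪ {2} ∪ {1}) ≤ R ({0} ∪ {2}) + R ({2} ∪ {1}) :=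
    matEntropy_reduce_strong_subadditivity hρ (by decide) (by decide) (by decide)
  have h1 : S {.inl 0} + S ({.inr 0} ∪ {.inl 0} ∪ {.inl 1})
      ≤ S ({.inr 0} ∪ {.inl 0}) + S ({.inl 0} ∪ {.inl 1}) :=
    matEntropy_reduce_strong_subadditivity hψ (by decide) (by decide) (by decide)
  have h2 : S {.inl 1} + S ({.inr 1} ∪ {.inl 1} ∪ ({.inr 0} ∪ {.inl 0}))
      ≤ S ({.inr 1} ∪ {.inl 1}) + S ({.inl 1} ∪ ({.inr 0} ∪ {.inl 0})) :=
    matEntropy_reduce_strong_subadditivity hψ (by decide) (by decide) (by decide)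
  rw [show ({0} ∪ {2} ∪ {1} : Finset (Fin 3)) = Finset.univ by decide,
    show ({0} ∪ {2} : Finset (Fin 3)) = {2, 0} by decide,
    show ({2} ∪ {1} : Finset (Fin 3)) = {1, 2} by decide,
    show R Finset.univ = matEntropy ρ from matEntropy_reduce_univ hρ.1] at h0
  rw [show ({.inr 0} ∪ {.inl 0} : Finset (Fin 3 ⊕ Fin 3)) = partyFinset id 0 by decide,
    show ({.inl 0} ∪ {.inl 1} : Finset (Fin 3 ⊕ Fin 3)) = Finset.image .inl {0, 1} by decide,
    show ({.inl 0} : Finset (Fin 3 ⊕ Fin 3)) = Finset.image .inl {0} by decide,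
    hSR, hSR] at h1
  rw [show ({.inr 1} ∪ {.inl 1} : Finset (Fin 3 ⊕ Fin 3)) = partyFinset id 1 by decide,
    show ({.inr 0} ∪ {.inl 0} : Finset (Fin 3 ⊕ Fin 3)) = partyFinset id 0 by decide,
    Finset.union_comm {.inl 1} (partyFinset id 0),
    show ({.inl 1} : Finset (Fin 3 ⊕ Fin 3)) = Finset.image .inl {1} by decide, hSR] at h2
  rw [show ({.inl 1} : Finset (Fin 3 ⊕ Fin 3)) = Finset.image .inl {1} by decide] at h1
  have h3 := hS (partyFinset id 2)
  have h4 := hS (partyFinset id 1 ∪ partyFinset id 0)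
  rw [Fin.sum_univ_three]
  simp only [S, R] at *
  linarith
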